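/- For each averaging ω ∈ Ω', the limit ℓ_ω(f) = lim_{n→∞} |Λ_n|^{-1} Σ_{x∈Λ_n} f(τ_x(ω)) exists for every bounded continuous f: Ω → ℝ, and there exists a unique probability measure P_ω on (Ω,F) such that E_{P_ω}(f) = ℓ_ω(f) for every bounded continuous f: Ω → ℝ. Moreover, P_ω is translation invariant: P_ω ∘ τ_x^{-1} = P_ω for all x ∈ Z^d. -/

import Mathlib

open MeasureTheory Filter Topology Matrix
open scoped ENNReal NNReal

noncomputable section

namespace DetCond

/-- Vertices of `ℤ^d`. -/
abbrev Vert (d : ℕ) := Fin d → ℤ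

/-- Index of the (unordered) nearest-neighbour edge `(x, x + e i)` of `ℤ^d`;
the set of these indices is in natural bijection with `E(ℤ^d)` modulo orientation. -/
abbrev EdgeIx (d : ℕ) := Vert d × Fin d

/-- The space `Ω = (0,∞)^{E(ℤ^d)}` of (symmetric) conductance configurations, with
its product topology and product σ-algebra. -/
abbrev EnvSp (d : ℕ) := {ω : EdgeIx d → ℝ // ∀ e, 0 < ω e}

/-- The `i`-th coordinate unit vector of `ℤ^d`. -/
def unitv (d : ℕ) (i : Fin d) : Vert d := fun j => if j = i then 1 else 0

/-- The translation `τ_x` acting on environments: `c_{τ_x ω}(y,z) = c_ω(y+x,z+x)`. -/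
def shift (d : ℕ) (x : Vert d) (ω : EnvSp d) : EnvSp d :=
  ⟨fun e => ω.1 (e.1 + x, e.2), fun e => ω.2 (e.1 + x, e.2)⟩

/-- The conductance `c_ω(x,y)`; it vanishes when `x,y` are not nearest neighbours
and is symmetric in `x,y` by construction. -/
def cnd (d : ℕ) (ω : EnvSp d) (x y : Vert d) : ℝ :=
  ∑ i, ((if y = x + unitv d i then ω.1 (x, i) else 0) +
        (if x = y + unitv d i then ω.1 (y, i) else 0))

/-- `π_ω(x) = Σ_{z : (x,z) ∈ E(ℤ^d)} c_ω(x,z)`. -/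
def piOf (d : ℕ) (ω : EnvSp d) (x : Vert d) : ℝ :=
  ∑ i, (ω.1 (x, i) + ω.1 (x - unitv d i, i))

/-- The box `Λ_r = [-r,r]^d ∩ ℤ^d`. -/
def box (d : ℕ) (r : ℝ) : Finset (Vert d) :=
  Fintype.piFinset fun _ : Fin d => Finset.Icc ⌈-r⌉ ⌊r⌋

/-- The nearest neighbours of `x` in `ℤ^d`. -/
def nbrs (d : ℕ) (x : Vert d) : Finset (Vert d) :=
  (Finset.univ.image fun i => x + unitv d i) ∪ (Finset.univ.image fun i => x - unitv d i)

/-- The set `E(Λ)` of edges incident with at least one vertex of `Λ`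
(one index per unordered edge). -/
def edgesIn (d : ℕ) (Λ : Finset (Vert d)) : Finset (EdgeIx d) :=
  Λ.biUnion fun x =>
    (Finset.univ.image fun i => (x, i)) ∪ (Finset.univ.image fun i => (x - unitv d i, i))

/-- Bounded functions on `Ω`. -/
def IsBdd (d : ℕ) (f : EnvSp d → ℝ) : Prop := ∃ M, ∀ ω, |f ω| ≤ M

/-- Local functions: `f` depends only on the coordinates in some finite set `B` of edges
and, viewed as a function of those coordinates, has compact support in `(0,∞)^B`. -/
def IsLocalFn (d : ℕ) (f : EnvSp d → ℝ) : Prop :=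
  ∃ B : Finset (EdgeIx d),
    (∀ ω₁ ω₂ : EnvSp d, (∀ e ∈ B, ω₁.1 e = ω₂.1 e) → f ω₁ = f ω₂) ∧
    ∃ a b : ℝ, 0 < a ∧ ∀ ω : EnvSp d, (∃ e ∈ B, ω.1 e < a ∨ b < ω.1 e) → f ω = 0

/-- `ℓ_ω(f) = L`, i.e. the block averages of the translates of `f` converge to `L`. -/
def avgTo (d : ℕ) (ω : EnvSp d) (f : EnvSp d → ℝ) (L : ℝ) : Prop :=
  Tendsto (fun n : ℕ => (∑ x ∈ box d (n : ℝ), f (shift d x ω)) / ((box d (n : ℝ)).card : ℝ))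
    atTop (𝓝 L)

/-- `ω` is averaging: `ℓ_ω(f)` exists for every continuous local `f`. -/
def Averaging (d : ℕ) (ω : EnvSp d) : Prop :=
  ∀ f : EnvSp d → ℝ, Continuous f → IsLocalFn d f → ∃ L, avgTo d ω f L

/-- `ω` is tempered, i.e. `ω ∈ Ω'`. -/
def Tempered (d : ℕ) (ω : EnvSp d) : Prop :=
  Tendsto (fun ε : ℝ =>
      limsup (fun n : ℕ =>
        (∑ e ∈ edgesIn d (box d (n : ℝ)),
            (if ε ≤ ω.1 e ∧ ω.1 e ≤ ε⁻¹ then (0:ℝ) else 1)) / (n : ℝ) ^ d) atTop)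
    (𝓝[>] 0) (𝓝 0)

/-- `P` is the measure `ℙ_ω` associated with an averaging tempered `ω`:
the unique probability measure whose expectation of every bounded continuous function
is the corresponding block-average limit `ℓ_ω(f)`. -/
def IsEnvLaw (d : ℕ) (ω : EnvSp d) (P : Measure (EnvSp d)) : Prop :=
  IsProbabilityMeasure P ∧
    ∀ f : EnvSp d → ℝ, Continuous f → IsBdd d f → avgTo d ω f (∫ ω', f ω' ∂P)

/-- Ergodicity of a measure on `Ω` with respect to the translations of `ℤ^d`. -/
def ErgodicEnv (d : ℕ) (P : Measure (EnvSp d)) : Prop :=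
  ∀ A : Set (EnvSp d), MeasurableSet A → (∀ x : Vert d, shift d x ⁻¹' A = A) →
    P A = 0 ∨ P A = 1

/-- `ω ∈ Ω⋆`: tempered, averaging, and the associated measure `ℙ_ω` is ergodic. -/
def InOmegaStar (d : ℕ) (ω : EnvSp d) : Prop :=
  Tempered d ω ∧ Averaging d ω ∧
    ∀ P : Measure (EnvSp d), IsEnvLaw d ω P → ErgodicEnv d P

/-- `ω ∈ Ω_{p,q}`. -/
def InOmegaPQ (d : ℕ) (p q : ℝ) (ω : EnvSp d) : Prop :=
  (∃ C : ℝ, ∀ n : ℕ, 1 ≤ n →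
      (∑ e ∈ edgesIn d (box d (n : ℝ)), ω.1 e ^ p) / (n : ℝ) ^ d ≤ C) ∧
  (∃ C : ℝ, ∀ n : ℕ, 1 ≤ n →
      (∑ e ∈ edgesIn d (box d (n : ℝ)), ω.1 e ^ (-q)) / (n : ℝ) ^ d ≤ C)

/-- The path space of the discrete-time walk. -/
abbrev Path (d : ℕ) := ℕ → Vert d

/-- One-step transition probabilities `𝖯_ω(x,y) = c_ω(x,y)/π_ω(x)`. -/
def transP (d : ℕ) (ω : EnvSp d) (x y : Vert d) : ℝ := cnd d ω x y / piOf d ω x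

/-- `μ` is the law `P_ω^{x₀}` of the random walk among the conductances `ω`
started at `x₀`: a probability measure on the path space with the prescribed
finite-dimensional (cylinder) probabilities. -/
def IsWalkLaw (d : ℕ) (ω : EnvSp d) (x₀ : Vert d) (μ : Measure (Path d)) : Prop :=
  IsProbabilityMeasure μ ∧
    ∀ (n : ℕ) (γ : ℕ → Vert d),
      μ {w | ∀ k ≤ n, w k = γ k} =
        (if γ 0 = x₀ then 1 else 0) *
          ∏ k ∈ Finset.range n, ENNReal.ofReal (transP d ω (γ k) (γ (k+1)))

/-- `n`-step transition probabilities of the discrete-time walk. -/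
def stepP (d : ℕ) (ω : EnvSp d) : ℕ → Vert d → Vert d → ℝ
  | 0, x, y => if x = y then 1 else 0
  | n+1, x, y => ∑ z ∈ nbrs d x, transP d ω x z * stepP d ω n z y

/-- `P_ω^x(Y_t = y)` for the constant-speed continuous-time walk `Y_t = X_{N(t)}`,
where `N` is an independent rate-1 Poisson process. -/
def ctP (d : ℕ) (ω : EnvSp d) (t : ℝ) (x y : Vert d) : ℝ :=
  ∑' k : ℕ, Real.exp (-t) * t ^ k / (Nat.factorial k : ℝ) * stepP d ω k x y

/-- The `ℓ¹`-norm of a vertex of `ℤ^d`. -/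
def l1 (d : ℕ) (x : Vert d) : ℝ := ∑ i, |(x i : ℝ)|

/-- A vertex of `ℤ^d` regarded as a point of `ℝ^d`. -/
def ivert (d : ℕ) (x : Vert d) : Fin d → ℝ := fun i => (x i : ℝ)

/-- The linearly interpolated diffusively rescaled walk `B^{(n)}`. -/
def BnProc (d : ℕ) (n : ℕ) (w : Path d) (t : ℝ) : Fin d → ℝ :=
  (Real.sqrt n)⁻¹ •
    (ivert d (w ⌊t * n⌋₊) +
      (t * n - (⌊t * n⌋₊ : ℝ)) • (ivert d (w (⌊t * n⌋₊ + 1)) - ivert d (w ⌊t * n⌋₊)))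


/-- The measure `ℚ_ω` obtained from `ℙ_ω` by tilting with `π(0)`. -/
def Qmeas (d : ℕ) (P : Measure (EnvSp d)) : Measure (EnvSp d) :=
  P.withDensity fun ω' => ENNReal.ofReal (piOf d ω' 0 / ∫ ω'', piOf d ω'' 0 ∂P)

/-- The inner product `⟨f,g⟩_{L²(πμ)}`. -/
def innerP (d : ℕ) (P : Measure (EnvSp d)) (f g : EnvSp d → ℝ) : ℝ :=
  ∫ ω', f ω' * g ω' * piOf d ω' 0 ∂P

/-- The Dirichlet pairing `⟨h, (−L)h⟩_{L²(πμ)}`. -/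
def quadL (d : ℕ) (P : Measure (EnvSp d)) (h : EnvSp d → ℝ) : ℝ :=
  ∫ ω', (∑ z ∈ nbrs d 0, cnd d ω' 0 z * (h ω' - h (shift d z ω'))) * h ω' ∂P

/-- The inner product of `L²(ν)`. -/
def innerQ (d : ℕ) (ν : Measure (EnvSp d)) (f g : EnvSp d → ℝ) : ℝ :=
  ∫ ω', f ω' * g ω' ∂ν

/-- The Dirichlet pairing `⟨h, (−L)h⟩_{L²(ν)}`. -/
def quadQ (d : ℕ) (ν : Measure (EnvSp d)) (h : EnvSp d → ℝ) : ℝ :=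
  ∫ ω', ((piOf d ω' 0)⁻¹ *
      ∑ z ∈ nbrs d 0, cnd d ω' 0 z * (h ω' - h (shift d z ω'))) * h ω' ∂ν

/-- The set whose supremum is the variational characterization
`⟨f,(−L)⁻¹f⟩_{L²(ν)} = sup_h [2⟨h,f⟩ − ⟨h,(−L)h⟩]` (over bounded continuous `h`);
`⟨f,(−L)⁻¹f⟩_{L²(ν)} < ∞` means this set is bounded above. -/
def invPairSet (d : ℕ) (ν : Measure (EnvSp d)) (f : EnvSp d → ℝ) : Set ℝ :=
  {r | ∃ h : EnvSp d → ℝ, Continuous h ∧ IsBdd d h ∧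
        r = 2 * innerQ d ν h f - quadQ d ν h}

/-- The function `f(ω) = π_ω(0)⁻¹ ∇⋆(c v)(ω)` built from a vector field `v`. -/
def fDiv (d : ℕ) (v : EnvSp d → Fin d → ℝ) (ω : EnvSp d) : ℝ :=
  (piOf d ω 0)⁻¹ *
    ∑ i, (cnd d ω 0 (unitv d i) * v ω i -
          cnd d ω (-(unitv d i)) 0 * v (shift d (-(unitv d i)) ω) i)

/-- The inner product of `ℓ²(Λ,π_ω)`. -/
def innerF (d : ℕ) (ω : EnvSp d) (Λ : Finset (Vert d)) (f g : Vert d → ℝ) : ℝ :=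
  ∑ x ∈ Λ, f x * g x * piOf d ω x

/-- The pairing `⟨h, (−𝖫_ω)h⟩_{ℓ²(Λ,π_ω)}` for `h` vanishing outside `Λ`. -/
def quadF (d : ℕ) (ω : EnvSp d) (Λ : Finset (Vert d)) (h : Vert d → ℝ) : ℝ :=
  ∑ x ∈ Λ, (∑ z ∈ nbrs d x, cnd d ω x z * (h x - h z)) * h x

/-- `⟨f, (−𝖫_ω)⁻¹_Λ f⟩_{ℓ²(Λ,π_ω)}` via its variational characterization
`sup_h [2⟨h,f⟩ − ⟨h,(−𝖫_ω)h⟩]` over `h ∈ ℓ²(Λ,π_ω)`. -/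
def invPairF (d : ℕ) (ω : EnvSp d) (Λ : Finset (Vert d)) (f : Vert d → ℝ) : ℝ :=
  sSup {r | ∃ h : Vert d → ℝ, (∀ x ∉ Λ, h x = 0) ∧
      r = 2 * innerF d ω Λ h f - quadF d ω Λ h}

/-- The antisymmetric edge function `v∘τ(ω)`: the value assigned to the
edge `(x, x+e_i)` is `v_i(τ_x(ω))`. -/
def efield (d : ℕ) (v : EnvSp d → Fin d → ℝ) (ω : EnvSp d) : Vert d → Fin d → ℝ :=
  fun x i => v (shift d x ω) i

/-- The discrete gradient `∇h` of `h : ℤ^d → ℝ` as an edge function. -/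
def dgradE (d : ℕ) (h : Vert d → ℝ) : Vert d → Fin d → ℝ :=
  fun x i => h (x + unitv d i) - h x

/-- The inner product `⟨u,w⟩_{ℓ²(E(Λ), c_ω)}` of (antisymmetric) edge functions;
each unordered edge is counted once, which agrees with the paper's sum over
ordered edges carrying the factor ½. -/
def einner (d : ℕ) (ω : EnvSp d) (Λ : Finset (Vert d)) (u w : Vert d → Fin d → ℝ) : ℝ :=
  ∑ e ∈ edgesIn d Λ, u e.1 e.2 * w e.1 e.2 * ω.1 e

/-- The Dirichlet energy `𝓔_Λ^ω(v)`. -/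
def direnergy (d : ℕ) (ω : EnvSp d) (Λ : Finset (Vert d)) (v : EnvSp d → Fin d → ℝ) : ℝ :=
  sInf {r | ∃ h : Vert d → ℝ, (∀ x ∉ Λ, h x = 0) ∧
      r = einner d ω Λ (fun x i => efield d v ω x i - dgradE d h x i)
            (fun x i => efield d v ω x i - dgradE d h x i)}

/-- The gradient `∇h` of a function on `Ω`. -/
def gradOmega (d : ℕ) (h : EnvSp d → ℝ) : EnvSp d → Fin d → ℝ :=
  fun ω i => h (shift d (unitv d i) ω) - h ω

/-- The inner product `⟨u, c w⟩_{L²(P,ℝ^d)}`. -/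
def cinnerP (d : ℕ) (P : Measure (EnvSp d)) (u w : EnvSp d → Fin d → ℝ) : ℝ :=
  ∑ i, ∫ ω', cnd d ω' 0 (unitv d i) * u ω' i * w ω' i ∂P

/-- Bounded vector fields on `Ω`. -/
def IsBddV (d : ℕ) (v : EnvSp d → Fin d → ℝ) : Prop := ∃ M, ∀ ω i, |v ω i| ≤ M

/-- The space `𝒱 = (ℝ^d)^{ℤ^d}` of vector fields on `ℤ^d`. -/
abbrev VS (d : ℕ) := Vert d → Fin d → ℝ

/-- The empirical measures `μ_r^{ω,v}` built from the minimizers `h_r` of the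
finite-volume Dirichlet energies. -/
def muR (d : ℕ) (ω : EnvSp d) (hr : ℕ → Vert d → ℝ) (r : ℕ) :
    Measure (EnvSp d × VS d) :=
  (((box d ((r : ℝ) + Real.sqrt r)).card : ℝ≥0∞) *
      ((box d (Real.sqrt r)).card : ℝ≥0∞))⁻¹ •
    ∑ z ∈ box d (Real.sqrt r), ∑ x ∈ box d ((r : ℝ) + Real.sqrt r),
      Measure.dirac (shift d (x + z) ω, fun y => dgradE d (hr r) (x + z + y))

/-- The localized conductances `c_ω^R`. -/
def cR (d : ℕ) (ω : EnvSp d) (R : ℝ) (e : EdgeIx d) : ℝ :=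
  if e ∈ edgesIn d (box d (2 * R)) then ω.1 e else 1

/-- The localized measure `π_ω^R`. -/
def piRloc (d : ℕ) (ω : EnvSp d) (R : ℝ) (x : Vert d) : ℝ :=
  if x ∈ box d (2 * R) then piOf d ω x
  else if x ∈ box d (4 * R) then 1 + piOf d ω x else 1

/-- The localized Dirichlet form `D_ω^R(f,f)` (each unordered edge counted once). -/
def DR (d : ℕ) (ω : EnvSp d) (R : ℝ) (f : Vert d → ℝ) : ℝ≥0∞ :=
  ∑' e : EdgeIx d, ENNReal.ofReal (cR d ω R e * (f (e.1 + unitv d e.2) - f e.1) ^ 2)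

/-- The norm `‖f‖_{ℓ^s(μ)}`. -/
def lpN (d : ℕ) (μw : Vert d → ℝ) (s : ℝ) (f : Vert d → ℝ) : ℝ≥0∞ :=
  (∑' x : Vert d, ENNReal.ofReal (|f x| ^ s * μw x)) ^ (1 / s)

/-- The exponent `ε = 2(2/d − 1/p − 1/q)((d−2)/d + 1/q)⁻¹`. -/
def epsPQ (d : ℕ) (p q : ℝ) : ℝ :=
  2 * (2 / (d : ℝ) - 1 / p - 1 / q) / (((d : ℝ) - 2) / (d : ℝ) + 1 / q)

/-- Jump rates of the localized constant-speed chain `Y^R`: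
rate `c_ω^R(x,y)/π_ω^R(x)` from `x` to `y`. -/
def rateR (d : ℕ) (ω : EnvSp d) (R : ℝ) (x y : Vert d) : ℝ :=
  (∑ i, ((if y = x + unitv d i then cR d ω R (x, i) else 0) +
         (if x = y + unitv d i then cR d ω R (y, i) else 0))) / piRloc d ω R x

/-- The generator matrix of `Y^R`. -/
def qmatR (d : ℕ) (ω : EnvSp d) (R : ℝ) (x y : Vert d) : ℝ :=
  if x = y then -(∑ z ∈ nbrs d x, rateR d ω R x z) else rateR d ω R x y

/-- Iterates of the generator matrix of `Y^R`. -/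
def qiter (d : ℕ) (ω : EnvSp d) (R : ℝ) : ℕ → Vert d → Vert d → ℝ
  | 0, x, y => if x = y then 1 else 0
  | n+1, x, y => ∑ z ∈ insert x (nbrs d x), qmatR d ω R x z * qiter d ω R n z y

/-- The heat kernel `P_ω^x(Y_t^R = y) = (e^{tQ})(x,y)` of the localized chain `Y^R`. -/
def hkR (d : ℕ) (ω : EnvSp d) (R : ℝ) (t : ℝ) (x y : Vert d) : ℝ :=
  ∑' k : ℕ, t ^ k / (Nat.factorial k : ℝ) * qiter d ω R k x y

/-! ### Boxes -/

lemma mem_box_natCast {d n : ℕ} {x : Vert d} :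
    x ∈ box d (n : ℝ) ↔ ∀ i, -(n : ℤ) ≤ x i ∧ x i ≤ n := by
  simp [box, Fintype.mem_piFinset, Int.ceil_neg]

lemma card_box_natCast (d n : ℕ) : (box d (n : ℝ)).card = (2 * n + 1) ^ d := by
  have h : ((n : ℤ) + 1 + n).toNat = 2 * n + 1 := by omega
  simp [box, Fintype.card_piFinset, Int.ceil_neg, h]

lemma card_box_pos (d n : ℕ) : 0 < (box d (n : ℝ)).card := by
  rw [card_box_natCast]; positivity

/-- A translate of `Λ_n` by a vector of sup-norm at most `k` lies in `Λ_{n+k}`. -/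
lemma add_mem_box {d n k : ℕ} {x y : Vert d} (hx : x ∈ box d (n : ℝ)) (hy : y ∈ box d (k : ℝ)) :
    x + y ∈ box d ((n + k : ℕ) : ℝ) := by
  rw [mem_box_natCast] at *
  intro i
  have := hx i
  have := hy i
  simp only [Pi.add_apply, Nat.cast_add]
  omega

lemma exists_mem_box {d : ℕ} (x : Vert d) : ∃ k : ℕ, x ∈ box d (k : ℝ) := by
  refine ⟨∑ i, (x i).natAbs, mem_box_natCast.2 fun i => ?_⟩
  have := Finset.single_le_sum (f := fun i => (x i).natAbs) (fun _ _ => Nat.zero_le _)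
    (Finset.mem_univ i)
  omega

lemma tendsto_card_box_ratio (d k : ℕ) :
    Tendsto (fun n : ℕ => ((box d ((n + k : ℕ) : ℝ)).card : ℝ) / ((box d (n : ℝ)).card : ℝ))
      atTop (𝓝 1) := by
  have h : Tendsto (fun n : ℕ => (1 + 2 * (k : ℝ) / (2 * n + 1)) ^ d) atTop (𝓝 1) := by
    have h0 : Tendsto (fun n : ℕ => (2 * (n : ℝ) + 1)) atTop atTop :=
      tendsto_atTop_add_const_right _ _
        (tendsto_natCast_atTop_atTop.const_mul_atTop (by norm_num))
    simpa using ((h0.const_div_atTop (2 * (k : ℝ))).const_add 1).pow d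
  refine h.congr fun n => ?_
  rw [card_box_natCast, card_box_natCast]
  push_cast
  rw [← div_pow]
  congr 1
  field_simp
  ring

lemma card_edgesIn_le (d : ℕ) (Λ : Finset (Vert d)) :
    (edgesIn d Λ).card ≤ Λ.card * (d + d) := by
  refine Finset.card_biUnion_le_card_mul _ _ _ fun x _ => (Finset.card_union_le _ _).trans ?_
  exact add_le_add (Finset.card_image_le.trans (by simp)) (Finset.card_image_le.trans (by simp))

lemma mem_edgesIn_of_mem {d : ℕ} {Λ : Finset (Vert d)} {x : Vert d} (hx : x ∈ Λ) (i : Fin d) :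
    (x, i) ∈ edgesIn d Λ :=
  Finset.mem_biUnion.2 ⟨x, hx, Finset.mem_union_left _ (Finset.mem_image_of_mem _ (by simp))⟩

/-! ### Translations -/

lemma continuous_shift (d : ℕ) (x : Vert d) : Continuous (shift d x) :=
  Continuous.subtype_mk
    (continuous_pi fun e => (continuous_apply (e.1 + x, e.2)).comp continuous_subtype_val) _

lemma shift_shift (d : ℕ) (x y : Vert d) (ω : EnvSp d) :
    shift d x (shift d y ω) = shift d (y + x) ω := by
  apply Subtype.ext
  funext e
  simp only [shift]
  rw [add_assoc, add_comm x y]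

/-- Block averages of a bounded function are asymptotically invariant under translations. -/
lemma avgTo_comp_shift {d : ℕ} {ω : EnvSp d} {f : EnvSp d → ℝ} {L : ℝ} (hf : IsBdd d f)
    (h : avgTo d ω f L) (x : Vert d) : avgTo d ω (fun ω' => f (shift d x ω')) L := by
  classical
  obtain ⟨M, hM⟩ := hf
  obtain ⟨k, hk⟩ := exists_mem_box x
  have key : ∀ (y : Vert d), y ∈ box d (k : ℝ) → ∀ n : ℕ,
      |∑ z ∈ box d ((n + k : ℕ) : ℝ), f (shift d z ω) -
        ∑ z ∈ box d (n : ℝ), f (shift d (z + y) ω)| ≤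
        M * ((box d ((n + k : ℕ) : ℝ)).card - (box d (n : ℝ)).card) := by
    intro y hy n
    have hinj : Set.InjOn (fun z : Vert d => z + y) (box d (n : ℝ)) :=
      (add_left_injective y).injOn
    have hsub : (box d (n : ℝ)).image (fun z => z + y) ⊆ box d ((n + k : ℕ) : ℝ) :=
      Finset.image_subset_iff.2 fun z hz => add_mem_box hz hy
    rw [← Finset.sum_image (f := fun z => f (shift d z ω)) hinj, ← Finset.sum_sdiff hsub,
      add_sub_cancel_right]
    refine (Finset.abs_sum_le_sum_abs _ _).trans
      ((Finset.sum_le_card_nsmul _ _ M fun z _ => hM _).trans_eq ?_)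
    rw [nsmul_eq_mul, Finset.cast_card_sdiff hsub, Finset.card_image_of_injOn hinj, mul_comm]
  have h0 : (0 : Vert d) ∈ box d (k : ℝ) := mem_box_natCast.2 fun i => by simp
  have hlim : Tendsto (fun n : ℕ => 2 * M *
      (((box d ((n + k : ℕ) : ℝ)).card : ℝ) / ((box d (n : ℝ)).card : ℝ) - 1)) atTop (𝓝 0) := by
    simpa using ((tendsto_card_box_ratio d k).sub_const 1).const_mul (2 * M)
  have hdiff := squeeze_zero_norm (f := fun n : ℕ =>
    (∑ z ∈ box d (n : ℝ), f (shift d x (shift d z ω))) / ((box d (n : ℝ)).card : ℝ) -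
      (∑ z ∈ box d (n : ℝ), f (shift d z ω)) / ((box d (n : ℝ)).card : ℝ)) (fun n => by
        have hpos : (0 : ℝ) < (box d (n : ℝ)).card := by exact_mod_cast card_box_pos d n
        rw [← sub_div, Real.norm_eq_abs, abs_div, abs_of_pos hpos, div_le_iff₀ hpos]
        have h1 := abs_le.1 (key x hk n)
        have h2 := abs_le.1 (key 0 h0 n)
        simp only [add_zero] at h2
        simp only [shift_shift]
        have : 2 * M * (((box d ((n + k : ℕ) : ℝ)).card : ℝ) / ((box d (n : ℝ)).card : ℝ) - 1) *
            ((box d (n : ℝ)).card : ℝ) =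
            2 * (M * ((box d ((n + k : ℕ) : ℝ)).card - (box d (n : ℝ)).card)) := by
          field_simp
        rw [this, abs_le]
        constructor <;> linarith [h1.1, h1.2, h2.1, h2.2]) hlim
  simpa [avgTo] using hdiff.add h

/-! ### Empirical measures -/

/-- The empirical measure of the translates of `ω` over the box `Λ_n`. -/
def empMeasure (d : ℕ) (ω : EnvSp d) (n : ℕ) : Measure (EnvSp d) :=
  ((box d (n : ℝ)).card : ℝ≥0∞)⁻¹ • ∑ x ∈ box d (n : ℝ), Measure.dirac (shift d x ω)

instance isProbabilityMeasure_empMeasure (d : ℕ) (ω : EnvSp d) (n : ℕ) :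
    IsProbabilityMeasure (empMeasure d ω n) := by
  refine ⟨?_⟩
  simp only [empMeasure, Measure.smul_apply, Measure.finsetSum_apply, measure_univ,
    Finset.sum_const, nsmul_eq_mul, mul_one, smul_eq_mul]
  exact ENNReal.inv_mul_cancel (by exact_mod_cast (card_box_pos d n).ne') (by simp)

/-- The empirical measure as an element of the space of probability measures. -/
def empProb (d : ℕ) (ω : EnvSp d) (n : ℕ) : ProbabilityMeasure (EnvSp d) :=
  ⟨empMeasure d ω n, inferInstance⟩

lemma integral_empMeasure {d : ℕ} (ω : EnvSp d) (n : ℕ) (f : EnvSp d → ℝ) :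
    ∫ ω', f ω' ∂(empMeasure d ω n) =
      (∑ x ∈ box d (n : ℝ), f (shift d x ω)) / ((box d (n : ℝ)).card : ℝ) := by
  rw [empMeasure, integral_smul_measure, integral_finsetSum_measure]
  · simp [integral_dirac, div_eq_inv_mul]
  · exact fun x _ => integrable_dirac (by simp)

lemma avgTo_iff_tendsto_integral {d : ℕ} {ω : EnvSp d} {f : EnvSp d → ℝ} {L : ℝ} :
    avgTo d ω f L ↔ Tendsto (fun n => ∫ ω', f ω' ∂(empMeasure d ω n)) atTop (𝓝 L) := by
  simp only [avgTo, integral_empMeasure]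

/-- The set of environments whose conductance at `e` is outside `[ε, ε⁻¹]`. -/
def badSet (d : ℕ) (e : EdgeIx d) (ε : ℝ) : Set (EnvSp d) :=
  {ω | ¬ (ε ≤ ω.1 e ∧ ω.1 e ≤ ε⁻¹)}

lemma measurableSet_badSet (d : ℕ) (e : EdgeIx d) (ε : ℝ) : MeasurableSet (badSet d e ε) := by
  have h : Measurable fun ω : EnvSp d => ω.1 e :=
    (measurable_pi_apply e).comp measurable_subtype_coe
  exact ((measurableSet_le measurable_const h).inter (measurableSet_le h measurable_const)).compl

lemma empMeasure_badSet_le {d : ℕ} {ω : EnvSp d} {n : ℕ} {e : EdgeIx d} {ε : ℝ} {η : ℝ≥0}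
    (h : ∑ x ∈ box d (n : ℝ),
      (if ε ≤ ω.1 (e.1 + x, e.2) ∧ ω.1 (e.1 + x, e.2) ≤ ε⁻¹ then (0 : ℝ) else 1) ≤
        η * (box d (n : ℝ)).card) :
    empMeasure d ω n (badSet d e ε) ≤ η := by
  classical
  have hsum : (∑ x ∈ box d (n : ℝ), Measure.dirac (shift d x ω)) (badSet d e ε) =
      ENNReal.ofReal (∑ x ∈ box d (n : ℝ),
        (if ε ≤ ω.1 (e.1 + x, e.2) ∧ ω.1 (e.1 + x, e.2) ≤ ε⁻¹ then (0 : ℝ) else 1)) := by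
    rw [ENNReal.ofReal_sum_of_nonneg fun x _ => by split_ifs <;> simp, Measure.finsetSum_apply]
    refine Finset.sum_congr rfl fun x _ => ?_
    rw [Measure.dirac_apply' _ (measurableSet_badSet d e ε), Set.indicator_apply]
    simp only [badSet, shift, Set.mem_ofPred_eq]
    split_ifs <;> simp_all
  rw [empMeasure, Measure.smul_apply, hsum, smul_eq_mul, mul_comm, ← div_eq_mul_inv]
  refine ENNReal.div_le_of_le_mul ((ENNReal.ofReal_le_ofReal h).trans_eq ?_)
  rw [ENNReal.ofReal_mul η.coe_nonneg]
  simp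

lemma ite_inv_bounds_antitone {c ε ε' : ℝ} (hε : 0 < ε) (h : ε ≤ ε') :
    (if ε ≤ c ∧ c ≤ ε⁻¹ then (0 : ℝ) else 1) ≤ if ε' ≤ c ∧ c ≤ ε'⁻¹ then (0 : ℝ) else 1 := by
  have h' : ε'⁻¹ ≤ ε⁻¹ := inv_anti₀ hε h
  split_ifs with h1 h2 h2 <;> try norm_num
  exact h1 ⟨h.trans h2.1, h2.2.trans h'⟩

lemma exists_inv_bounds {d : ℕ} (ω : EnvSp d) (S : Finset (EdgeIx d)) :
    ∃ ε : ℝ, 0 < ε ∧ ∀ e ∈ S, ε ≤ ω.1 e ∧ ω.1 e ≤ ε⁻¹ := by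
  have h : ∀ᶠ ε : ℝ in 𝓝[>] 0, ∀ e ∈ S, ε ≤ ω.1 e ∧ ω.1 e ≤ ε⁻¹ := by
    rw [Finset.eventually_all]
    intro e _
    exact ((eventually_le_nhds (ω.2 e)).filter_mono nhdsWithin_le_nhds).and
      (tendsto_inv_nhdsGT_zero.eventually_ge_atTop _)
  exact (eventually_mem_nhdsWithin.and h).exists

lemma isBoundedUnder_bad_density {d : ℕ} (hd : 1 ≤ d) (ω : EnvSp d) (ε : ℝ) :
    IsBoundedUnder (· ≤ ·) atTop fun n : ℕ =>
      (∑ e ∈ edgesIn d (box d (n : ℝ)),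
        (if ε ≤ ω.1 e ∧ ω.1 e ≤ ε⁻¹ then (0:ℝ) else 1)) / (n : ℝ) ^ d := by
  refine ⟨3 ^ d * (d + d), eventually_map.2 (eventually_atTop.2 ⟨1, fun n hn => ?_⟩)⟩
  have hn' : (1 : ℝ) ≤ n := by exact_mod_cast hn
  refine (div_le_iff₀ (by positivity)).2 ?_
  calc ∑ e ∈ edgesIn d (box d (n : ℝ)), (if ε ≤ ω.1 e ∧ ω.1 e ≤ ε⁻¹ then (0:ℝ) else 1)
      ≤ ∑ e ∈ edgesIn d (box d (n : ℝ)), 1 :=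
        Finset.sum_le_sum fun e _ => by split_ifs <;> norm_num
    _ = ((edgesIn d (box d (n : ℝ))).card : ℝ) := by simp
    _ ≤ (2 * (n : ℝ) + 1) ^ d * (d + d) := by
        have := card_edgesIn_le d (box d (n : ℝ))
        rw [card_box_natCast] at this
        exact_mod_cast this
    _ ≤ (3 * (n : ℝ)) ^ d * (d + d) := by gcongr; linarith
    _ = 3 ^ d * (d + d) * (n : ℝ) ^ d := by rw [mul_pow]; ring

/-- For tempered `ω`, each single-edge marginal of the empirical measures is tight
in `(0, ∞)`. -/
lemma exists_empMeasure_badSet_le {d : ℕ} (hd : 1 ≤ d) {ω : EnvSp d} (hT : Tempered d ω)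
    (e : EdgeIx d) {η : ℝ≥0} (hη : 0 < η) :
    ∃ ε : ℝ, 0 < ε ∧ ∀ n, empMeasure d ω n (badSet d e ε) ≤ η := by
  classical
  obtain ⟨k, hk⟩ := exists_mem_box e.1
  obtain ⟨ε₀, hε₀, hlim⟩ :=
    (eventually_mem_nhdsWithin.and (hT.eventually_lt_const (NNReal.coe_pos.2 hη))).exists
  obtain ⟨N, hN⟩ := eventually_atTop.1
    (eventually_lt_of_limsup_lt hlim (isBoundedUnder_bad_density hd ω ε₀))
  obtain ⟨ε₁, hε₁, hsmall⟩ := exists_inv_bounds ω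
    ((box d ((N + k + 1 : ℕ) : ℝ)).image fun x => (e.1 + x, e.2))
  have hε : 0 < min ε₀ ε₁ := lt_min hε₀ hε₁
  refine ⟨min ε₀ ε₁, hε, fun n => empMeasure_badSet_le ?_⟩
  rcases le_or_gt n (N + k + 1) with hn | hn
  · rw [Finset.sum_eq_zero fun x hx => ?_]
    · positivity
    · refine le_antisymm ((ite_inv_bounds_antitone hε (min_le_right _ _)).trans_eq
        (if_pos (hsmall _ (Finset.mem_image_of_mem _ ?_)))) (by split_ifs <;> simp)
      rw [mem_box_natCast] at hx ⊢
      intro i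
      have := hx i
      omega
  · have hpos : (0 : ℝ) < ((n + k : ℕ) : ℝ) ^ d := by
      have : 0 < n + k := by omega
      positivity
    have hbad := (div_lt_iff₀ hpos).1 (hN (n + k) (by omega))
    have hinj : Set.InjOn (fun x : Vert d => (e.1 + x, e.2)) (box d (n : ℝ)) :=
      fun x _ y _ hxy => by simpa using hxy
    calc ∑ x ∈ box d (n : ℝ), (if min ε₀ ε₁ ≤ ω.1 (e.1 + x, e.2) ∧
            ω.1 (e.1 + x, e.2) ≤ (min ε₀ ε₁)⁻¹ then (0 : ℝ) else 1)
        ≤ ∑ x ∈ box d (n : ℝ),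
            (if ε₀ ≤ ω.1 (e.1 + x, e.2) ∧ ω.1 (e.1 + x, e.2) ≤ ε₀⁻¹ then (0 : ℝ) else 1) :=
          Finset.sum_le_sum fun x _ => ite_inv_bounds_antitone hε (min_le_left _ _)
      _ = ∑ e' ∈ (box d (n : ℝ)).image (fun x => (e.1 + x, e.2)),
            (if ε₀ ≤ ω.1 e' ∧ ω.1 e' ≤ ε₀⁻¹ then (0 : ℝ) else 1) := by
          rw [Finset.sum_image hinj]
      _ ≤ ∑ e' ∈ edgesIn d (box d ((n + k : ℕ) : ℝ)),
            (if ε₀ ≤ ω.1 e' ∧ ω.1 e' ≤ ε₀⁻¹ then (0 : ℝ) else 1) := by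
          refine Finset.sum_le_sum_of_subset_of_nonneg (Finset.image_subset_iff.2 fun x hx => ?_)
            fun _ _ _ => by split_ifs <;> simp
          rw [add_comm e.1 x]
          exact mem_edgesIn_of_mem (add_mem_box hx hk) _
      _ ≤ η * ((n + k : ℕ) : ℝ) ^ d := hbad.le
      _ ≤ η * (box d (n : ℝ)).card := by
          rw [card_box_natCast]
          have : n + k ≤ 2 * n + 1 := by omega
          gcongr
          exact_mod_cast Nat.pow_le_pow_left this d

lemma isCompact_setOf_inv_bounds (d : ℕ) {ε : EdgeIx d → ℝ} (hε : ∀ e, 0 < ε e) :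
    IsCompact {ω : EnvSp d | ∀ e, ε e ≤ ω.1 e ∧ ω.1 e ≤ (ε e)⁻¹} := by
  rw [Topology.IsEmbedding.subtypeVal.isCompact_iff]
  convert isCompact_univ_pi fun e => isCompact_Icc (a := ε e) (b := (ε e)⁻¹) using 1
  ext c
  constructor
  · rintro ⟨ω, hω, rfl⟩ e -
    exact hω e
  · intro hc
    exact ⟨⟨c, fun e => (hε e).trans_le (hc e trivial).1⟩, fun e => hc e trivial, rfl⟩

/-- The empirical measures of a tempered environment are tight. -/
lemma isTightMeasureSet_empProb {d : ℕ} (hd : 1 ≤ d) {ω : EnvSp d} (hT : Tempered d ω) :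
    IsTightMeasureSet
      {((μ : ProbabilityMeasure (EnvSp d)) : Measure (EnvSp d)) | μ ∈ Set.range (empProb d ω)} := by
  rw [isTightMeasureSet_iff_exists_isCompact_measure_compl_le]
  intro δ hδ
  obtain ⟨η, hη, hsum⟩ := ENNReal.exists_pos_sum_of_countable hδ.ne' (EdgeIx d)
  choose ε hε hbad using fun e => exists_empMeasure_badSet_le hd hT e (hη e)
  refine ⟨_, isCompact_setOf_inv_bounds d hε, ?_⟩
  rintro _ ⟨_, ⟨n, rfl⟩, rfl⟩
  have hcompl : {ω : EnvSp d | ∀ e, ε e ≤ ω.1 e ∧ ω.1 e ≤ (ε e)⁻¹}ᶜ = ⋃ e, badSet d e (ε e) := by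
    ext ω'
    simp only [badSet, Set.mem_compl_iff, Set.mem_ofPred_eq, Set.mem_iUnion, not_forall]
  rw [hcompl]
  exact (measure_iUnion_le _).trans ((ENNReal.tsum_le_tsum fun e => hbad e n).trans hsum.le)

/-! ### Continuous local functions determine the measure -/

/-- A continuous cutoff on `(0, ∞)`, supported in `[(k+1)⁻¹, k+1]`. -/
def cutoff (k : ℕ) (t : ℝ) : ℝ :=
  max 0 (min 1 (min ((k + 1) * t - 1) (k + 1 - t)))

lemma continuous_cutoff (k : ℕ) : Continuous (cutoff k) := by
  unfold cutoff; fun_prop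

lemma cutoff_nonneg (k : ℕ) (t : ℝ) : 0 ≤ cutoff k t := le_max_left _ _

lemma cutoff_le_one (k : ℕ) (t : ℝ) : cutoff k t ≤ 1 := max_le zero_le_one (min_le_left _ _)

lemma cutoff_eq_zero {k : ℕ} {t : ℝ} (h : t < ((k : ℝ) + 1)⁻¹ ∨ (k : ℝ) + 1 < t) :
    cutoff k t = 0 := by
  refine max_eq_left ((min_le_right _ _).trans ?_)
  rcases h with h | h
  · have hk : (0 : ℝ) < k + 1 := by positivity
    have := (mul_lt_mul_iff_right₀ hk).2 h
    rw [mul_inv_cancel₀ hk.ne'] at this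
    exact (min_le_left _ _).trans (by linarith)
  · exact (min_le_right _ _).trans (by linarith)

lemma tendsto_cutoff {t : ℝ} (ht : 0 < t) : Tendsto (fun k => cutoff k t) atTop (𝓝 1) := by
  have h : Tendsto (fun k : ℕ => (k : ℝ) + 1) atTop atTop :=
    tendsto_atTop_add_const_right _ _ tendsto_natCast_atTop_atTop
  refine tendsto_const_nhds.congr' ?_
  filter_upwards [h.eventually_ge_atTop (2 / t), h.eventually_ge_atTop (1 + t)] with k h1 h2
  rw [div_le_iff₀ ht] at h1
  rw [cutoff, min_eq_left (le_min (by linarith) (by linarith)), max_eq_right zero_le_one]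

/-- A probability measure on `Ω` is determined by its integrals of continuous local functions. -/
lemma ext_of_integral_localFn {d : ℕ} {P Q : Measure (EnvSp d)} [IsProbabilityMeasure P]
    [IsProbabilityMeasure Q]
    (h : ∀ f : EnvSp d → ℝ, Continuous f → IsLocalFn d f → ∫ ω, f ω ∂P = ∫ ω, f ω ∂Q) :
    P = Q := by
  have hemb : MeasurableEmbedding (Subtype.val : EnvSp d → EdgeIx d → ℝ) := by
    refine MeasurableEmbedding.subtype_coe ?_
    have : {c : EdgeIx d → ℝ | ∀ e, 0 < c e} = ⋂ e, {c | 0 < c e} := by ext; simp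
    exact (congrArg MeasurableSet this).mpr <| MeasurableSet.iInter fun e =>
      measurableSet_lt measurable_const (measurable_pi_apply e)
  rw [← hemb.comap_map P, ← hemb.comap_map Q]
  congr 1
  have hmeas : Measurable (Subtype.val : EnvSp d → EdgeIx d → ℝ) := measurable_subtype_coe
  have := Measure.isProbabilityMeasure_map (μ := P) hmeas.aemeasurable
  have := Measure.isProbabilityMeasure_map (μ := Q) hmeas.aemeasurable
  refine IsProjectiveLimit.unique
    (P := fun I : Finset (EdgeIx d) => (Q.map Subtype.val).map I.restrict) (fun I => ?_)
    (fun I => rfl)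
  have hI : Measurable (I.restrict : (EdgeIx d → ℝ) → I → ℝ) := I.measurable_restrict
  simp only [Measure.map_map hI hmeas]
  have hm : Measurable (I.restrict ∘ (Subtype.val : EnvSp d → EdgeIx d → ℝ)) := hI.comp hmeas
  have hc : Continuous (I.restrict ∘ (Subtype.val : EnvSp d → EdgeIx d → ℝ)) :=
    (Finset.continuous_restrict I).comp continuous_subtype_val
  have := Measure.isProbabilityMeasure_map (μ := P) hm.aemeasurable
  have := Measure.isProbabilityMeasure_map (μ := Q) hm.aemeasurable
  refine ext_of_forall_integral_eq_of_IsFiniteMeasure fun g => ?_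
  rw [integral_map hm.aemeasurable g.continuous.aestronglyMeasurable,
    integral_map hm.aemeasurable g.continuous.aestronglyMeasurable]
  set F : ℕ → EnvSp d → ℝ := fun k ω => g (I.restrict ω.1) * ∏ e ∈ I, cutoff k (ω.1 e) with hF
  have hFc : ∀ k, Continuous (F k) := fun k =>
    (g.continuous.comp hc).mul (continuous_finsetProd _ fun e _ =>
      (continuous_cutoff k).comp ((continuous_apply e).comp continuous_subtype_val))
  have hFl : ∀ k, IsLocalFn d (F k) := fun k => by
    refine ⟨I, fun ω₁ ω₂ heq => ?_, ((k : ℝ) + 1)⁻¹, k + 1, by positivity, ?_⟩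
    · have h1 : I.restrict ω₁.1 = I.restrict ω₂.1 := funext fun e => heq e e.2
      have h2 : ∏ e ∈ I, cutoff k (ω₁.1 e) = ∏ e ∈ I, cutoff k (ω₂.1 e) :=
        Finset.prod_congr rfl fun e he => by rw [heq e he]
      simp only [hF, h1, h2]
    · rintro ω ⟨e, he, hcut⟩
      exact mul_eq_zero_of_right _ (Finset.prod_eq_zero he (cutoff_eq_zero hcut))
  have hlim : ∀ (ν : Measure (EnvSp d)) [IsProbabilityMeasure ν],
      Tendsto (fun k => ∫ ω, F k ω ∂ν) atTop
        (𝓝 (∫ ω, g ((I.restrict ∘ (Subtype.val : EnvSp d → EdgeIx d → ℝ)) ω) ∂ν)) := by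
    intro ν _
    refine tendsto_integral_of_dominated_convergence (fun _ => ‖g‖)
      (fun k => (hFc k).aestronglyMeasurable) (integrable_const _)
      (fun k => Eventually.of_forall fun ω => ?_) (Eventually.of_forall fun ω => ?_)
    · rw [hF, norm_mul]
      refine (mul_le_of_le_one_right (norm_nonneg _) ?_).trans (g.norm_coe_le_norm _)
      rw [Real.norm_of_nonneg (Finset.prod_nonneg fun e _ => cutoff_nonneg k _)]
      exact Finset.prod_le_one (fun e _ => cutoff_nonneg k _) fun e _ => cutoff_le_one k _
    · have := tendsto_finsetProd I fun e _ => tendsto_cutoff (ω.2 e)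
      simpa [hF] using this.const_mul (g (I.restrict ω.1))
  refine tendsto_nhds_unique (hlim P) ?_
  simp only [fun k => h (F k) (hFc k) (hFl k)]
  exact hlim Q

/-! ### Bounded continuous functions and weak limits -/

/-- A bounded continuous function on `Ω`, bundled. -/
def toBCF {d : ℕ} {f : EnvSp d → ℝ} (hf : Continuous f) (hb : IsBdd d f) :
    BoundedContinuousFunction (EnvSp d) ℝ :=
  BoundedContinuousFunction.ofNormedAddCommGroup f hf hb.choose hb.choose_spec

lemma IsLocalFn.isBdd {d : ℕ} {f : EnvSp d → ℝ} (hf : Continuous f) (hl : IsLocalFn d f) :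
    IsBdd d f := by
  classical
  obtain ⟨B, hB, a, b, ha, hab⟩ := hl
  obtain ⟨M, hM⟩ : ∃ M, ∀ ω ∈ {ω : EnvSp d | ∀ e, min a (max b a)⁻¹ ≤ ω.1 e ∧
      ω.1 e ≤ (min a (max b a)⁻¹)⁻¹}, ‖f ω‖ ≤ M :=
    (isCompact_setOf_inv_bounds d fun _ =>
      lt_min ha (inv_pos.2 (ha.trans_le (le_max_right _ _)))).exists_bound_of_continuousOn
        hf.continuousOn
  have hm : 0 < max b a := ha.trans_le (le_max_right _ _)
  have hmin : 0 < min a (max b a)⁻¹ := lt_min ha (inv_pos.2 hm)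
  refine ⟨max M 0, fun ω => ?_⟩
  by_cases hω : ∃ e ∈ B, ω.1 e < a ∨ b < ω.1 e
  · simp [hab ω hω]
  · push Not at hω
    let ω' : EnvSp d := ⟨fun e => if e ∈ B then ω.1 e else a, fun e => by
      dsimp only
      split_ifs
      exacts [ω.2 e, ha]⟩
    have heq : f ω = f ω' := hB _ _ fun e he => by simp [ω', he]
    rw [heq, ← Real.norm_eq_abs]
    refine (hM ω' fun e => ?_).trans (le_max_left _ _)
    have h1 : max b a ≤ (min a (max b a)⁻¹)⁻¹ := by
      rw [le_inv_comm₀ hm hmin]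
      exact min_le_right _ _
    by_cases he : e ∈ B
    · simp only [ω', he, if_true]
      exact ⟨(min_le_left _ _).trans (hω e he).1,
        ((hω e he).2.trans (le_max_left _ _)).trans h1⟩
    · simp only [ω', he, if_false]
      exact ⟨min_le_left _ _, (le_max_right _ _).trans h1⟩

lemma continuous_integral_probabilityMeasure {d : ℕ} {f : EnvSp d → ℝ} (hf : Continuous f)
    (hb : IsBdd d f) :
    Continuous fun P : ProbabilityMeasure (EnvSp d) => ∫ ω, f ω ∂(P : Measure (EnvSp d)) :=
  continuous_iff_continuousAt.2 fun _ =>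
    ProbabilityMeasure.tendsto_iff_forall_integral_tendsto.1 tendsto_id (toBCF hf hb)

instance hasOuterApproxClosed_envSp (d : ℕ) : HasOuterApproxClosed (EnvSp d) :=
  have := TopologicalSpace.metrizableSpace_of_t3_secondCountable (EdgeIx d → ℝ)
  have : TopologicalSpace.MetrizableSpace (EnvSp d) :=
    Topology.IsEmbedding.subtypeVal.metrizableSpace
  letI := TopologicalSpace.pseudoMetrizableSpacePseudoMetric (EnvSp d)
  inferInstance

/-- The empirical measures of an averaging tempered environment converge weakly. -/
lemma exists_tendsto_empProb {d : ℕ} (hd : 1 ≤ d) {ω : EnvSp d} (hA : Averaging d ω)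
    (hT : Tempered d ω) : ∃ P, Tendsto (empProb d ω) atTop (𝓝 P) := by
  have hK := isCompact_closure_of_isTightMeasureSet (isTightMeasureSet_empProb hd hT)
  have hmem : ∀ n, empProb d ω n ∈ closure (Set.range (empProb d ω)) :=
    fun n => subset_closure ⟨n, rfl⟩
  have hcl : ∀ Q, MapClusterPt Q atTop (empProb d ω) → ∀ f : EnvSp d → ℝ, Continuous f →
      IsLocalFn d f → ∀ L, avgTo d ω f L → ∫ ω', f ω' ∂(Q : Measure (EnvSp d)) = L := by
    intro Q hQ f hf hl L hL
    have h1 := hQ.continuousAt_comp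
      (continuous_integral_probabilityMeasure hf (hl.isBdd hf)).continuousAt
    have := (h1.clusterPt.mono (avgTo_iff_tendsto_integral.1 hL)).neBot
    exact eq_of_nhds_neBot this
  obtain ⟨P, -, hP⟩ := hK.exists_mapClusterPt (f := atTop) (u := empProb d ω)
    (tendsto_principal.2 (Eventually.of_forall hmem))
  refine ⟨P, hK.tendsto_nhds_of_unique_mapClusterPt (Eventually.of_forall hmem)
    fun Q _ hQ => Subtype.ext (ext_of_integral_localFn (P := (Q : Measure (EnvSp d)))
      (Q := (P : Measure (EnvSp d))) fun f hf hl => ?_)⟩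
  obtain ⟨L, hL⟩ := hA f hf hl
  exact (hcl Q hQ f hf hl L hL).trans (hcl P hP f hf hl L hL).symm

/-- Proposition 2.2: for each averaging tempered `ω`, the block-average
limit `ℓ_ω(f)` exists for every bounded continuous `f`, there is a unique probability
measure `ℙ_ω` with `E_{ℙ_ω}(f) = ℓ_ω(f)` for all such `f`, and `ℙ_ω` is translation
invariant. -/
theorem statement0 (d : ℕ) (hd : 1 ≤ d) (ω : EnvSp d)
    (hA : Averaging d ω) (hT : Tempered d ω) :
    (∀ f : EnvSp d → ℝ, Continuous f → IsBdd d f → ∃ L, avgTo d ω f L) ∧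
    (∃! P : Measure (EnvSp d), IsProbabilityMeasure P ∧
        ∀ f : EnvSp d → ℝ, Continuous f → IsBdd d f → avgTo d ω f (∫ ω', f ω' ∂P)) ∧
    (∀ P : Measure (EnvSp d),
        (IsProbabilityMeasure P ∧
          ∀ f : EnvSp d → ℝ, Continuous f → IsBdd d f → avgTo d ω f (∫ ω', f ω' ∂P)) →
        ∀ x : Vert d, P.map (shift d x) = P) := by
  obtain ⟨P, hP⟩ := exists_tendsto_empProb hd hA hT
  have hPavg : ∀ f : EnvSp d → ℝ, Continuous f → IsBdd d f →
      avgTo d ω f (∫ ω', f ω' ∂(P : Measure (EnvSp d))) := fun f hf hb =>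
    avgTo_iff_tendsto_integral.2
      (((continuous_integral_probabilityMeasure hf hb).tendsto P).comp hP)
  have hbdd : ∀ g : BoundedContinuousFunction (EnvSp d) ℝ, IsBdd d g :=
    fun g => ⟨‖g‖, g.norm_coe_le_norm⟩
  refine ⟨fun f hf hb => ⟨_, hPavg f hf hb⟩, ⟨P, ⟨inferInstance, hPavg⟩, ?_⟩, ?_⟩
  · rintro Q ⟨hQ, hQavg⟩
    exact ext_of_forall_integral_eq_of_IsFiniteMeasure fun g =>
      tendsto_nhds_unique (hQavg g g.continuous (hbdd g)) (hPavg g g.continuous (hbdd g))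
  · rintro Q ⟨hQ, hQavg⟩ x
    have hx := continuous_shift d x
    have := Measure.isProbabilityMeasure_map (μ := Q) hx.measurable.aemeasurable
    refine ext_of_forall_integral_eq_of_IsFiniteMeasure fun g => ?_
    rw [integral_map hx.measurable.aemeasurable g.continuous.aestronglyMeasurable]
    exact tendsto_nhds_unique
      (hQavg _ (g.continuous.comp hx) ⟨‖g‖, fun ω' => g.norm_coe_le_norm _⟩)
      (avgTo_comp_shift (hbdd g) (hQavg g g.continuous (hbdd g)) x)


end DetCond
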